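/- Let φ = [w_1, …, w_m] ∈ ℝ^{d×m} be a feature extractor every column of which is a scalar multiple (possibly zero) of e_1. Let S = {(x_i, y_i)}_{i=1}^n be a finite dataset with y_i = (x_{i[1]})^2 for all i, and suppose some sample satisfies x_{i[1]} ≠ 0. Then every head θ ∈ ℝ^m achieving zero empirical squared loss on S (i.e., f_{θ,φ}(x_i) = y_i for all i) satisfies E_{(x,y)∼D_t}[(f_{θ,φ}(x) − y)^2] = 0, i.e., it recovers the target ground truth. -/

import Mathlib

open MeasureTheory Finset

noncomputable section

/-- Uniform measure on `{-1, 0, 1} ⊆ ℝ`. -/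
def unif3 : Measure ℝ :=
  (PMF.uniformOfFinset ({-1, 0, 1} : Finset ℝ) (by norm_num)).toMeasure

/-- Uniform measure on `{-1, 1} ⊆ ℝ`. -/
def unif2 : Measure ℝ :=
  (PMF.uniformOfFinset ({-1, 1} : Finset ℝ) (by norm_num)).toMeasure

/-- Distribution of `x` conditioned on `y = 0` under the source distribution `D_s^(k)`. -/
def srcBranch0 (d k : ℕ) : Measure (Fin d → ℝ) :=
  Measure.pi (fun i => if (i : ℕ) < k then Measure.dirac (0 : ℝ) else unif3)

/-- Distribution of `x` conditioned on `y = 1` under the source distribution `D_s^(k)`. -/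
def srcBranch1 (d k : ℕ) : Measure (Fin d → ℝ) :=
  Measure.pi (fun i => if (i : ℕ) < k then unif2 else unif3)

/-- The source distribution `D_s^(k)` on `ℝ^d × ℝ`. -/
def sourceMeasure (d k : ℕ) : Measure ((Fin d → ℝ) × ℝ) :=
  (1/3 : ENNReal) • (srcBranch0 d k).map (fun x => (x, (0 : ℝ)))
    + (2/3 : ENNReal) • (srcBranch1 d k).map (fun x => (x, (1 : ℝ)))

/-- The target distribution `D_t = D_s^(1)`. -/
def targetMeasure (d : ℕ) : Measure ((Fin d → ℝ) × ℝ) := sourceMeasure d 1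

/-- The two-layer quadratic network `f_{θ,φ}(x) = ∑ i, θ i (w_i ⬝ x)^2`,
where `w_i` is the `i`-th column of `φ`. -/
def qnet {d m : ℕ} (θ : Fin m → ℝ) (φ : Matrix (Fin d) (Fin m) ℝ) (x : Fin d → ℝ) : ℝ :=
  ∑ i, θ i * (∑ j, φ j i * x j) ^ 2

/-- Population squared loss on the distribution `D`. -/
def popLoss {d m : ℕ} (D : Measure ((Fin d → ℝ) × ℝ)) (θ : Fin m → ℝ)
    (φ : Matrix (Fin d) (Fin m) ℝ) : ℝ :=
  ∫ p, (qnet θ φ p.1 - p.2) ^ 2 ∂D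

/-- Empirical squared loss on the dataset `S`. -/
def empLoss {d m n : ℕ} (S : Fin n → (Fin d → ℝ) × ℝ) (θ : Fin m → ℝ)
    (φ : Matrix (Fin d) (Fin m) ℝ) : ℝ :=
  (1 / (n : ℝ)) * ∑ i, (qnet θ φ (S i).1 - (S i).2) ^ 2

/-- Squared Frobenius norm of the feature extractor. -/
def frobSq {d m : ℕ} (φ : Matrix (Fin d) (Fin m) ℝ) : ℝ := ∑ j, ∑ i, (φ j i) ^ 2

/-- Squared Euclidean norm of a head. -/
def normSq {m : ℕ} (θ : Fin m → ℝ) : ℝ := ∑ i, (θ i) ^ 2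

/-- The regularized joint training objective `L_joint^λ`. -/
def jointObj {d m n : ℕ} (k : ℕ) (α lam : ℝ) (S : Fin n → (Fin d → ℝ) × ℝ)
    (θs θt : Fin m → ℝ) (φ : Matrix (Fin d) (Fin m) ℝ) : ℝ :=
  (1 - α) * popLoss (sourceMeasure d k) θs φ + α * empLoss S θt φ
    + lam * (normSq θs + normSq θt + frobSq φ)

end

theorem aux_qnet {d m : ℕ} (hd : 0 < d) (θ : Fin m → ℝ) (φ : Matrix (Fin d) (Fin m) ℝ)
    (c : Fin m → ℝ)
    (hc : ∀ i : Fin m, ∀ l : Fin d, φ l i = c i * (if (l : ℕ) = 0 then 1 else 0))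
    (x : Fin d → ℝ) : qnet θ φ x = (∑ i, θ i * c i ^ 2) * x ⟨0, hd⟩ ^ 2 := by
  unfold qnet
  rw [Finset.sum_mul]
  refine Finset.sum_congr rfl fun i _ => ?_
  have : ∑ j, φ j i * x j = c i * x ⟨0, hd⟩ := by
    rw [Finset.sum_eq_single (⟨0, hd⟩ : Fin d)]
    · simp [hc]
    · intro b _ hb
      have : (b : ℕ) ≠ 0 := fun h => hb (Fin.ext h)
      simp [hc, this]
    · simp
  rw [this]; ring

instance aux_u3 : IsProbabilityMeasure unif3 := by
  unfold unif3; infer_instance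

instance aux_u2 : IsProbabilityMeasure unif2 := by
  unfold unif2; infer_instance

theorem aux_ae2 : ∀ᵐ t ∂unif2, t ^ 2 = 1 := by
  have hm : MeasurableSet {t : ℝ | t ^ 2 = 1} :=
    measurableSet_eq_fun (by fun_prop) (by fun_prop)
  rw [ae_iff]
  unfold unif2
  rw [← Set.compl_setOf, PMF.toMeasure_apply_eq_zero_iff _ hm.compl, PMF.support_uniformOfFinset,
    Set.disjoint_left]
  intro a ha
  simp only [coe_insert, coe_singleton, Set.mem_insert_iff, Set.mem_singleton_iff] at ha
  rcases ha with rfl | rfl <;> simp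

theorem aux_ae (d : ℕ) (hd : 0 < d) :
    ∀ᵐ p ∂(targetMeasure d), p.1 ⟨0, hd⟩ ^ 2 = p.2 := by
  have hm : MeasurableSet {p : (Fin d → ℝ) × ℝ | p.1 ⟨0, hd⟩ ^ 2 = p.2} :=
    measurableSet_eq_fun (by fun_prop) (by fun_prop)
  unfold targetMeasure sourceMeasure
  rw [ae_add_measure_iff]
  constructor
  · refine Measure.ae_smul_measure ?_ _
    rw [ae_map_iff (by fun_prop) hm]
    unfold srcBranch0
    haveI : ∀ i : Fin d, IsProbabilityMeasure
        (if (i : ℕ) < 1 then Measure.dirac (0 : ℝ) else unif3) := by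
      intro i; split_ifs <;> infer_instance
    refine (Measure.tendsto_eval_ae_ae (i := (⟨0, hd⟩ : Fin d))).eventually
      (p := fun t : ℝ => t ^ 2 = 0) ?_
    simp [ae_dirac_eq]
  · refine Measure.ae_smul_measure ?_ _
    rw [ae_map_iff (by fun_prop) hm]
    unfold srcBranch1
    haveI : ∀ i : Fin d, IsProbabilityMeasure
        (if (i : ℕ) < 1 then unif2 else unif3) := by
      intro i; split_ifs <;> infer_instance
    refine (Measure.tendsto_eval_ae_ae (i := (⟨0, hd⟩ : Fin d))).eventually
      (p := fun t : ℝ => t ^ 2 = 1) ?_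
    simpa only [Nat.lt_one_iff, if_true] using aux_ae2

/-- If every column of `φ` is a multiple of `e_1`, the dataset has labels
`y_i = (x_i)_{[1]}²` and contains a sample with `(x_i)_{[1]} ≠ 0`, then any head `θ`
achieving zero empirical loss recovers the target ground truth, i.e. has zero target
population loss. -/
theorem e1_feature_interpolant_recovers_ground_truth (d m n : ℕ) (hd : 0 < d)
    (φ : Matrix (Fin d) (Fin m) ℝ)
    (hφ : ∀ i : Fin m, ∃ c : ℝ, ∀ l : Fin d, φ l i = c * (if (l : ℕ) = 0 then 1 else 0))
    (S : Fin n → (Fin d → ℝ) × ℝ)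
    (hy : ∀ i : Fin n, (S i).2 = ((S i).1 ⟨0, hd⟩) ^ 2)
    (hx : ∃ i : Fin n, (S i).1 ⟨0, hd⟩ ≠ 0)
    (θ : Fin m → ℝ) (hfit : ∀ i : Fin n, qnet θ φ (S i).1 = (S i).2) :
    popLoss (targetMeasure d) θ φ = 0 := by
  choose c hc using hφ
  obtain ⟨i, hi⟩ := hx
  have h1 := hfit i
  rw [hy i, aux_qnet hd θ φ c hc] at h1
  have hA : ∑ i, θ i * c i ^ 2 = 1 := mul_right_cancel₀ (pow_ne_zero 2 hi) (by rw [h1, one_mul])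
  unfold popLoss
  apply integral_eq_zero_of_ae
  filter_upwards [aux_ae d hd] with p hp
  simp [aux_qnet hd θ φ c hc, hA, hp]
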